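/- (Inclusion theorem) Let E and F be Banach spaces and let 1 ≤ b_j ≤ a_j < ∞ for j = 1,2 with b_1 ≤ b_2, a_1 ≤ a_2 and 1/b_1 − 1/a_1 ≤ 1/b_2 − 1/a_2. Then every continuous linear operator u : E → F that is absolutely (a_1,b_1)-summing is also absolutely (a_2,b_2)-summing. -/

import Mathlib

open scoped ENNReal NNReal BigOperators ZeroAtInfty

noncomputable section

/-- The `k`-th Rademacher function on `[0,1]`. -/
def Rademacher (k : ℕ) (t : ℝ) : ℝ := (-1 : ℝ) ^ ⌊(2 : ℝ) ^ (k + 1) * t⌋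

/-- A Banach space `E` has cotype `q` (for `2 ≤ q < ∞`). -/
def HasCotype (q : ℝ) (E : Type*) [NormedAddCommGroup E] [NormedSpace ℝ E] : Prop :=
  2 ≤ q ∧ ∃ C > 0, ∀ (n : ℕ) (x : Fin n → E),
    (∑ k : Fin n, ‖x k‖ ^ q) ^ (1 / q) ≤
      C * (∫ t in (0:ℝ)..(1:ℝ), ‖∑ k : Fin n, Rademacher k.1 t • x k‖ ^ 2) ^ ((1:ℝ) / 2)

/-- `cot E`, the infimum of the cotypes of `E` (`∞` if `E` has no finite cotype). -/
def cot (E : Type*) [NormedAddCommGroup E] [NormedSpace ℝ E] : ℝ≥0∞ :=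
  sInf {c : ℝ≥0∞ | ∃ q : ℝ, HasCotype q E ∧ c = ENNReal.ofReal q}

/-- Conjugate exponent in `ℝ≥0∞` : `p* = p/(p-1)`, with `1* = ∞` and `∞* = 1`. -/
def conjE (p : ℝ≥0∞) : ℝ≥0∞ := 1 + 1 / (p - 1)

/-- A sequence is weakly `p`-summable. -/
def WeaklySummable {E : Type*} [NormedAddCommGroup E] [NormedSpace ℝ E]
    (p : ℝ) (x : ℕ → E) : Prop :=
  ∀ φ : E →L[ℝ] ℝ, Summable fun j => |φ (x j)| ^ p

/-- `u : E → F` is absolutely `(q,p)`-summing. -/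
def AbsolutelySumming {E F : Type*} [NormedAddCommGroup E] [NormedSpace ℝ E]
    [NormedAddCommGroup F] [NormedSpace ℝ F] (q p : ℝ) (u : E →L[ℝ] F) : Prop :=
  ∀ x : ℕ → E, WeaklySummable p x → Summable fun j => ‖u (x j)‖ ^ q

/-- The weak `ℓ_p` norm of a sequence. -/
def weakNorm {E : Type*} [NormedAddCommGroup E] [NormedSpace ℝ E] (p : ℝ) (x : ℕ → E) : ℝ :=
  ⨆ φ : {φ : E →L[ℝ] ℝ // ‖φ‖ ≤ 1}, (∑' j, |φ.1 (x j)| ^ p) ^ (1 / p)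

/-- A continuous `m`-linear operator is multiple `(q,p)`-summing. -/
def MultipleSumming {m : ℕ} {E : Fin m → Type*} [∀ i, NormedAddCommGroup (E i)]
    [∀ i, NormedSpace ℝ (E i)] {F : Type*} [NormedAddCommGroup F] [NormedSpace ℝ F]
    (q p : ℝ) (T : ContinuousMultilinearMap ℝ E F) : Prop :=
  ∃ C > 0, ∀ x : (i : Fin m) → ℕ → E i, (∀ i, WeaklySummable p (x i)) →
    (Summable fun j : Fin m → ℕ => ‖T (fun i => x i (j i))‖ ^ q) ∧
    (∑' j : Fin m → ℕ, ‖T (fun i => x i (j i))‖ ^ q) ^ (1 / q) ≤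
      C * ∏ i, weakNorm p (x i)


/-- Abel-Dini, divergent half: if `∑ wₙ / (1 + w₀ + ⋯ + wₙ)` converges, so does `∑ wₙ`. -/
lemma summable_of_summable_div_partialSum {w : ℕ → ℝ} (hw : ∀ n, 0 ≤ w n)
    (hs : Summable fun n => w n / (1 + ∑ i ∈ Finset.range (n + 1), w i)) : Summable w := by
  set S : ℕ → ℝ := fun n => 1 + ∑ i ∈ Finset.range n, w i with hS
  have hSpos : ∀ n, 0 < S n := fun n => by
    have := Finset.sum_nonneg fun i (_ : i ∈ Finset.range n) => hw i
    simp only [hS]; linarith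
  have hSsucc : ∀ n, S (n + 1) = S n + w n := fun n => by
    simp only [hS, Finset.sum_range_succ]; ring
  have hSmono : Monotone S := monotone_nat_of_le_succ fun n => by
    rw [hSsucc]; linarith [hw n]
  have hs' : Summable fun n => w n / S (n + 1) := hs
  have hnn : ∀ n, 0 ≤ w n / S (n + 1) := fun n => div_nonneg (hw n) (hSpos _).le
  obtain ⟨N, hN⟩ := ((hs'.hasSum.tendsto_sum_nat).eventually
    (lt_mem_nhds (sub_lt_self _ (one_half_pos (α := ℝ))))).exists
  refine summable_of_sum_range_le (c := 2 * S N) hw fun n => ?_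
  have key : ∀ k, (S (N + k) - S N) / S (N + k) ≤
      ∑ i ∈ Finset.range k, w (N + i) / S (N + i + 1) := fun k => by
    have h1 : S (N + k) - S N = ∑ i ∈ Finset.range k, w (N + i) := by
      have := Finset.sum_range_add w N k
      simp only [hS]; linarith
    rw [h1, Finset.sum_div]
    refine Finset.sum_le_sum fun i hi => ?_
    have hik : N + i + 1 ≤ N + k := by have := Finset.mem_range.1 hi; omega
    exact div_le_div_of_nonneg_left (hw _) (hSpos _) (hSmono hik)
  have htot := hs'.sum_le_tsum (Finset.range (N + n)) fun i _ => hnn i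
  rw [Finset.sum_range_add] at htot
  have h2 : (S (N + n) - S N) / S (N + n) ≤ 1 / 2 := by linarith [key n]
  rw [div_le_iff₀ (hSpos _)] at h2
  have h3 : S n ≤ S (N + n) := hSmono (by omega)
  have h4 : ∑ i ∈ Finset.range n, w i = S n - 1 := by simp only [hS]; ring
  linarith

/-- Abel-Dini, convergent half: `∑ wₙ / (1 + w₀ + ⋯ + wₙ) ^ p` converges for `p > 1`. -/
lemma summable_div_partialSum_rpow {w : ℕ → ℝ} (hw : ∀ n, 0 ≤ w n) {p : ℝ} (hp : 1 < p) :
    Summable fun n => w n / (1 + ∑ i ∈ Finset.range (n + 1), w i) ^ p := by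
  set S : ℕ → ℝ := fun n => 1 + ∑ i ∈ Finset.range n, w i with hS
  have hSpos : ∀ n, 0 < S n := fun n => by
    have := Finset.sum_nonneg fun i (_ : i ∈ Finset.range n) => hw i
    simp only [hS]; linarith
  have hSsucc : ∀ n, S (n + 1) = S n + w n := fun n => by
    simp only [hS, Finset.sum_range_succ]; ring
  have hq : 0 < p - 1 := by linarith
  have step : ∀ n, (p - 1) * (w n / S (n + 1) ^ p) ≤
      S n ^ (-(p - 1)) - S (n + 1) ^ (-(p - 1)) := fun n => by
    have ht : 0 < S n / S (n + 1) := div_pos (hSpos _) (hSpos _)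
    have h1 : 1 + (p - 1) * (1 - S n / S (n + 1)) ≤ (S n / S (n + 1)) ^ (-(p - 1)) := by
      rw [Real.rpow_def_of_pos ht]
      have := Real.add_one_le_exp (Real.log (S n / S (n + 1)) * -(p - 1))
      nlinarith [Real.log_le_sub_one_of_pos ht]
    have h2 : 0 < S (n + 1) ^ (-(p - 1)) := Real.rpow_pos_of_pos (hSpos _) _
    rw [Real.div_rpow (hSpos _).le (hSpos _).le, le_div_iff₀ h2] at h1
    have h3 : w n / S (n + 1) ^ p = (1 - S n / S (n + 1)) * S (n + 1) ^ (-(p - 1)) := by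
      have h4 : S (n + 1) ^ (-(p - 1)) = S (n + 1) / S (n + 1) ^ p := by
        rw [show -(p - 1) = 1 - p by ring, Real.rpow_sub (hSpos _), Real.rpow_one]
      have h5 := (hSpos (n + 1)).ne'
      rw [h4, eq_sub_of_add_eq' (hSsucc n).symm]
      field_simp
    rw [h3]; linarith
  have hnn : ∀ n, 0 ≤ w n / S (n + 1) ^ p := fun n =>
    div_nonneg (hw n) (Real.rpow_nonneg (hSpos _).le _)
  change Summable fun n => w n / S (n + 1) ^ p
  refine (summable_mul_left_iff hq.ne').1
    (summable_of_sum_range_le (c := S 0 ^ (-(p - 1)))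
      (fun n => mul_nonneg hq.le (hnn n)) fun n => ?_)
  calc _ ≤ ∑ i ∈ Finset.range n, (S i ^ (-(p - 1)) - S (i + 1) ^ (-(p - 1))) :=
        Finset.sum_le_sum fun i _ => step i
    _ = S 0 ^ (-(p - 1)) - S n ^ (-(p - 1)) :=
        Finset.sum_range_sub' (fun i => S i ^ (-(p - 1))) n
    _ ≤ _ := sub_le_self _ (Real.rpow_nonneg (hSpos _).le _)

/-- Nonnegative `ℓ_p` sequences are `ℓ_q` for `0 < p ≤ q`. -/
lemma Summable.rpow_of_exponent_le {y : ℕ → ℝ} (hy : ∀ n, 0 ≤ y n) {p q : ℝ} (hp : 0 < p)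
    (hpq : p ≤ q) (hs : Summable fun n => y n ^ p) : Summable fun n => y n ^ q := by
  refine hs.of_norm_bounded_eventually_nat ?_
  filter_upwards [hs.tendsto_atTop_zero.eventually (ge_mem_nhds one_pos)] with n hn
  rw [Real.norm_of_nonneg (Real.rpow_nonneg (hy n) _)]
  refine Real.rpow_le_rpow_of_exponent_ge' (hy n) ?_ hp.le hpq
  by_contra! hlt
  exact absurd hn (not_le.2 (Real.one_lt_rpow hlt hp))

/-- Converse Hölder inequality: a nonnegative sequence multiplying `ℓ_r` into `ℓ_a` lies in `ℓ_p`,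
where `1 / p = 1 / a - 1 / r`. -/
lemma summable_rpow_of_forall_mul {y : ℕ → ℝ} (hy : ∀ n, 0 ≤ y n) {a r p : ℝ} (ha : 0 < a)
    (har : a < r) (hp : 0 < p) (hpar : 1 / p = 1 / a - 1 / r)
    (H : ∀ c : ℕ → ℝ, (∀ n, 0 ≤ c n) → (Summable fun n => c n ^ r) →
      Summable fun n => (c n * y n) ^ a) :
    Summable fun n => y n ^ p := by
  have hr : 0 < r := ha.trans har
  have hw : ∀ n, 0 ≤ y n ^ p := fun n => Real.rpow_nonneg (hy n) _
  set S : ℕ → ℝ := fun n => 1 + ∑ i ∈ Finset.range (n + 1), y i ^ p with hS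
  have hSpos : ∀ n, 0 < S n := fun n => by
    have := Finset.sum_nonneg fun i (_ : i ∈ Finset.range (n + 1)) => hw i
    simp only [hS]; linarith
  have hexp : p / r * a + a = p := by field_simp at hpar ⊢; linarith
  refine summable_of_summable_div_partialSum hw ?_
  have hc := H (fun n => y n ^ (p / r) / S n ^ (1 / a))
    (fun n => div_nonneg (Real.rpow_nonneg (hy n) _) (Real.rpow_nonneg (hSpos n).le _)) ?_
  · refine hc.congr fun n => ?_
    rw [Real.mul_rpow (div_nonneg (Real.rpow_nonneg (hy n) _) (Real.rpow_nonneg (hSpos n).le _))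
      (hy n), Real.div_rpow (Real.rpow_nonneg (hy n) _) (Real.rpow_nonneg (hSpos n).le _),
      ← Real.rpow_mul (hy n), ← Real.rpow_mul (hSpos n).le, one_div_mul_cancel ha.ne',
      Real.rpow_one, div_mul_eq_mul_div, ← Real.rpow_add_of_nonneg (hy n) (by positivity) ha.le,
      hexp]
  · refine (summable_div_partialSum_rpow hw ((one_lt_div ha).2 har)).congr fun n => ?_
    rw [Real.div_rpow (Real.rpow_nonneg (hy n) _) (Real.rpow_nonneg (hSpos n).le _),
      ← Real.rpow_mul (hy n), ← Real.rpow_mul (hSpos n).le, div_mul_cancel₀ _ hr.ne',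
      one_div_mul_eq_div]

/-- Multiplying a weakly `q`-summable sequence by an `ℓ_r` sequence gives a weakly `p`-summable
one, where `1 / p = 1 / r + 1 / q`. -/
lemma WeaklySummable.smul {E : Type*} [NormedAddCommGroup E] [NormedSpace ℝ E] {x : ℕ → E}
    {p q r : ℝ} (hp : 0 < p) (hq : 0 < q) (hr : 0 < r) (hpqr : 1 / p = 1 / r + 1 / q)
    (hx : WeaklySummable q x) {c : ℕ → ℝ} (hc : ∀ n, 0 ≤ c n)
    (hcr : Summable fun n => c n ^ r) : WeaklySummable p fun n => c n • x n := by
  intro φ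
  have hconj : (r / p).HolderConjugate (q / p) := by
    refine Real.holderConjugate_iff.2 ⟨?_, ?_⟩
    · rw [one_lt_div hp]
      have : 1 / r < 1 / p := by rw [hpqr]; linarith [one_div_pos.2 hq]
      exact (one_div_lt_one_div hr hp).1 this
    · field_simp at hpqr ⊢; linarith
  have := Real.summable_mul_of_Lp_Lq_of_nonneg (f := fun n => c n ^ p)
    (g := fun n => |φ (x n)| ^ p) hconj (fun n => Real.rpow_nonneg (hc n) _)
    (fun n => Real.rpow_nonneg (abs_nonneg _) _) ?_ ?_
  · refine this.congr fun n => ?_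
    rw [map_smul, smul_eq_mul, abs_mul, abs_of_nonneg (hc n), Real.mul_rpow (hc n) (abs_nonneg _)]
  · refine hcr.congr fun n => ?_
    rw [← Real.rpow_mul (hc n), mul_div_cancel₀ _ hp.ne']
  · refine (hx φ).congr fun n => ?_
    rw [← Real.rpow_mul (abs_nonneg _), mul_div_cancel₀ _ hp.ne']

/-- inclusion theorem: if `1 ≤ b_j ≤ a_j`, `b₁ ≤ b₂`, `a₁ ≤ a₂` and
`1/b₁ − 1/a₁ ≤ 1/b₂ − 1/a₂`, then `(a₁,b₁)`-summing implies `(a₂,b₂)`-summing. -/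
theorem stmt19 (E F : Type*) [NormedAddCommGroup E] [NormedSpace ℝ E] [CompleteSpace E]
    [NormedAddCommGroup F] [NormedSpace ℝ F] [CompleteSpace F]
    (a₁ a₂ b₁ b₂ : ℝ) (hb₁ : 1 ≤ b₁) (hb₂ : 1 ≤ b₂) (hba₁ : b₁ ≤ a₁) (hba₂ : b₂ ≤ a₂)
    (hb : b₁ ≤ b₂) (ha : a₁ ≤ a₂) (h : 1 / b₁ - 1 / a₁ ≤ 1 / b₂ - 1 / a₂)
    (u : E →L[ℝ] F) (hu : AbsolutelySumming a₁ b₁ u) :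
    AbsolutelySumming a₂ b₂ u := by
  intro x hx
  have hb₁' : 0 < b₁ := by linarith
  have hb₂' : 0 < b₂ := by linarith
  have ha₁' : 0 < a₁ := by linarith
  have ha₂' : 0 < a₂ := by linarith
  rcases hb.eq_or_lt with rfl | hlt
  · exact (hu x hx).rpow_of_exponent_le (fun n => norm_nonneg _) ha₁' ha
  have hpos : 0 < 1 / b₁ - 1 / b₂ := sub_pos.2 (one_div_lt_one_div_of_lt hb₁' hlt)
  obtain ⟨r, hr⟩ : ∃ r, 1 / r = 1 / b₁ - 1 / b₂ := ⟨1 / (1 / b₁ - 1 / b₂), one_div_one_div _⟩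
  have hr0 : 0 < r := one_div_pos.1 (hr ▸ hpos)
  have ha₂inv : 0 < 1 / a₂ := one_div_pos.2 ha₂'
  obtain ⟨p, hp⟩ : ∃ p, 1 / p = 1 / a₁ - 1 / r := ⟨1 / (1 / a₁ - 1 / r), one_div_one_div _⟩
  have hle : 1 / a₂ ≤ 1 / p := by linarith
  have hp0 : 0 < p := one_div_pos.1 (ha₂inv.trans_le hle)
  have har : a₁ < r := (one_div_lt_one_div hr0 ha₁').1 (by linarith)
  refine Summable.rpow_of_exponent_le (fun n => norm_nonneg _) hp0
    ((one_div_le_one_div ha₂' hp0).1 hle) ?_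
  refine summable_rpow_of_forall_mul (fun n => norm_nonneg _) ha₁' har hp0 hp fun c hc hcr => ?_
  refine (hu _ (hx.smul hb₁' hb₂' hr0 (by linarith) hc hcr)).congr fun n => ?_
  rw [map_smul, norm_smul, Real.norm_of_nonneg (hc n)]

end
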